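/- arXiv:1601.07744 — 2 statements merged into one kernel-verified Lean document; each statement's English description precedes it below -/
import Mathlib

section
/- Let λ, μ ∈ ℝ with μ > 0 and λ + μ > 0, set α := (λ+μ)/(λ+3μ), let R > 0 and let k ≥ 1 be an integer. Define w_k : ℝ² \ {0} → ℝ² in polar coordinates by w_k(x) = R^{2k} ( r^{−k} cos(kθ) + kα(r²−R²) r^{−k−2} cos((k+2)θ), −r^{−k} sin(kθ) + kα(r²−R²) r^{−k−2} sin((k+2)θ) ). Then μ Δw_k + (λ+μ)∇(∇·w_k) = 0 at every point of ℝ² \ {0}. -/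
open Real MeasureTheory

noncomputable section

/-- Partial derivative in the first coordinate direction. -/
def pdx (f : ℝ × ℝ → ℝ) (x : ℝ × ℝ) : ℝ := fderiv ℝ f x (1, 0)

/-- Partial derivative in the second coordinate direction. -/
def pdy (f : ℝ × ℝ → ℝ) (x : ℝ × ℝ) : ℝ := fderiv ℝ f x (0, 1)

/-- Divergence of a planar vector field. -/
def div2 (u : ℝ × ℝ → ℝ × ℝ) (x : ℝ × ℝ) : ℝ :=
  pdx (fun y => (u y).1) x + pdy (fun y => (u y).2) x

/-- Componentwise Laplacian. -/
def lap2 (f : ℝ × ℝ → ℝ) (x : ℝ × ℝ) : ℝ :=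
  pdx (fun y => pdx f y) x + pdy (fun y => pdy f y) x

/-- The Lamé operator  μ Δu + (λ+μ) ∇(∇·u). -/
def lame2 (lam mu : ℝ) (u : ℝ × ℝ → ℝ × ℝ) (x : ℝ × ℝ) : ℝ × ℝ :=
  (mu * lap2 (fun y => (u y).1) x + (lam + mu) * pdx (fun y => div2 u y) x,
   mu * lap2 (fun y => (u y).2) x + (lam + mu) * pdy (fun y => div2 u y) x)

/-- Conormal derivative  λ(∇·u)ν + μ(∇u + (∇u)ᵀ)ν. -/
def trac (lam mu : ℝ) (u : ℝ × ℝ → ℝ × ℝ) (x ν : ℝ × ℝ) : ℝ × ℝ :=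
  (lam * div2 u x * ν.1
      + mu * (2 * pdx (fun y => (u y).1) x * ν.1
        + (pdy (fun y => (u y).1) x + pdx (fun y => (u y).2) x) * ν.2),
   lam * div2 u x * ν.2
      + mu * ((pdy (fun y => (u y).1) x + pdx (fun y => (u y).2) x) * ν.1
        + 2 * pdy (fun y => (u y).2) x * ν.2))

/-- Entries of the symmetric gradient ∇ˢu = (∇u + (∇u)ᵀ)/2. -/
def sg11 (u : ℝ × ℝ → ℝ × ℝ) (x : ℝ × ℝ) : ℝ := pdx (fun y => (u y).1) x

def sg12 (u : ℝ × ℝ → ℝ × ℝ) (x : ℝ × ℝ) : ℝ :=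
  (pdy (fun y => (u y).1) x + pdx (fun y => (u y).2) x) / 2

def sg22 (u : ℝ × ℝ → ℝ × ℝ) (x : ℝ × ℝ) : ℝ := pdy (fun y => (u y).2) x

/-- Frobenius inner product ∇ˢu : ∇ˢv of the symmetric gradients of two fields. -/
def sgFrob (u v : ℝ × ℝ → ℝ × ℝ) (x : ℝ × ℝ) : ℝ :=
  sg11 u x * sg11 v x + 2 * (sg12 u x * sg12 v x) + sg22 u x * sg22 v x

/-- Euclidean norm on ℝ². -/
def nr (x : ℝ × ℝ) : ℝ := Real.sqrt (x.1 ^ 2 + x.2 ^ 2)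

/-- `f` is differentiable at `p`, with partial derivatives `a` and `b`. -/
def HasPartials (f : ℝ × ℝ → ℝ) (a b : ℝ) (p : ℝ × ℝ) : Prop :=
  HasFDerivAt f (a • ContinuousLinearMap.fst ℝ ℝ ℝ + b • ContinuousLinearMap.snd ℝ ℝ ℝ) p

namespace HasPartials

variable {f g : ℝ × ℝ → ℝ} {a b a' b' : ℝ} {p : ℝ × ℝ}

theorem pdx_eq (h : HasPartials f a b p) : pdx f p = a := by
  simp [pdx, HasFDerivAt.fderiv h]

theorem pdy_eq (h : HasPartials f a b p) : pdy f p = b := by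
  simp [pdy, HasFDerivAt.fderiv h]

theorem add (hf : HasPartials f a b p) (hg : HasPartials g a' b' p) :
    HasPartials (fun q => f q + g q) (a + a') (b + b') p := by
  refine (HasFDerivAt.fun_add hf hg).congr_fderiv ?_
  ext <;> simp

theorem sub (hf : HasPartials f a b p) (hg : HasPartials g a' b' p) :
    HasPartials (fun q => f q - g q) (a - a') (b - b') p := by
  refine (HasFDerivAt.fun_sub hf hg).congr_fderiv ?_
  ext <;> simp

theorem mul (hf : HasPartials f a b p) (hg : HasPartials g a' b' p) :
    HasPartials (fun q => f q * g q) (f p * a' + g p * a) (f p * b' + g p * b) p := by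
  refine (HasFDerivAt.fun_mul hf hg).congr_fderiv ?_
  ext <;> simp

theorem const_mul (c : ℝ) (hf : HasPartials f a b p) :
    HasPartials (fun q => c * f q) (c * a) (c * b) p := by
  refine (HasFDerivAt.const_mul hf c).congr_fderiv ?_
  ext <;> simp

theorem fst (p : ℝ × ℝ) : HasPartials (fun q => q.1) 1 0 p := by
  refine hasFDerivAt_fst.congr_fderiv ?_
  ext <;> simp

theorem snd (p : ℝ × ℝ) : HasPartials (fun q => q.2) 0 1 p := by
  refine hasFDerivAt_snd.congr_fderiv ?_
  ext <;> simp

end HasPartials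

theorem eventuallyEq_of_eqOn_ne_zero {f g : ℝ × ℝ → ℝ} (h : ∀ p, p ≠ 0 → f p = g p)
    {p : ℝ × ℝ} (hp : p ≠ 0) : f =ᶠ[nhds p] g :=
  Filter.eventuallyEq_of_mem (isOpen_ne.mem_nhds hp) h

theorem pdx_congr_of_ne_zero {f g : ℝ × ℝ → ℝ} (h : ∀ p, p ≠ 0 → f p = g p)
    {p : ℝ × ℝ} (hp : p ≠ 0) : pdx f p = pdx g p := by
  rw [pdx, pdx, (eventuallyEq_of_eqOn_ne_zero h hp).fderiv_eq]

theorem pdy_congr_of_ne_zero {f g : ℝ × ℝ → ℝ} (h : ∀ p, p ≠ 0 → f p = g p)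
    {p : ℝ × ℝ} (hp : p ≠ 0) : pdy f p = pdy g p := by
  rw [pdy, pdy, (eventuallyEq_of_eqOn_ne_zero h hp).fderiv_eq]

/-- The real part of `z⁻ⁿ`, `z = x + iy`. -/
def invPowRe (n : ℕ) (p : ℝ × ℝ) : ℝ := ((Complex.equivRealProdCLM.symm p ^ n)⁻¹).re

/-- The imaginary part of `z⁻ⁿ`, `z = x + iy`. -/
def invPowIm (n : ℕ) (p : ℝ × ℝ) : ℝ := ((Complex.equivRealProdCLM.symm p ^ n)⁻¹).im

theorem hasFDerivAt_inv_pow (n : ℕ) {p : ℝ × ℝ} (hp : p ≠ 0) :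
    HasFDerivAt (fun q : ℝ × ℝ => (Complex.equivRealProdCLM.symm q ^ n)⁻¹)
      ((-(n : ℂ) * (Complex.equivRealProdCLM.symm p ^ (n + 1))⁻¹) •
        (Complex.equivRealProdCLM.symm : ℝ × ℝ →L[ℝ] ℂ)) p := by
  have hz : Complex.equivRealProdCLM.symm p ≠ 0 := by simpa using hp
  have hd : HasDerivAt (fun z : ℂ => (z ^ n)⁻¹)
      (-(n : ℂ) * (Complex.equivRealProdCLM.symm p ^ (n + 1))⁻¹)
      (Complex.equivRealProdCLM.symm p) := by
    have h := hasDerivAt_zpow (-(n : ℤ)) _ (Or.inl hz)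
    rw [show (-(n : ℤ) - 1) = -((n + 1 : ℕ) : ℤ) by push_cast; ring] at h
    simpa only [zpow_neg, zpow_natCast, Int.cast_neg, Int.cast_natCast] using h
  exact hd.comp_hasFDerivAt p
    (Complex.equivRealProdCLM.symm : ℝ × ℝ →L[ℝ] ℂ).hasFDerivAt

theorem hasPartials_invPowRe (n : ℕ) {p : ℝ × ℝ} (hp : p ≠ 0) :
    HasPartials (invPowRe n) (-n * invPowRe (n + 1) p) (n * invPowIm (n + 1) p) p := by
  refine (Complex.reCLM.hasFDerivAt.comp p (hasFDerivAt_inv_pow n hp)).congr_fderiv ?_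
  ext <;> simp [invPowRe, invPowIm, Complex.equivRealProdCLM_symm_apply, -Complex.inv_re,
    -Complex.inv_im]

theorem hasPartials_invPowIm (n : ℕ) {p : ℝ × ℝ} (hp : p ≠ 0) :
    HasPartials (invPowIm n) (-n * invPowIm (n + 1) p) (-n * invPowRe (n + 1) p) p := by
  refine (Complex.imCLM.hasFDerivAt.comp p (hasFDerivAt_inv_pow n hp)).congr_fderiv ?_
  ext <;> simp [invPowRe, invPowIm, Complex.equivRealProdCLM_symm_apply, -Complex.inv_re,
    -Complex.inv_im]

theorem inv_pow_polar (n : ℕ) (r θ : ℝ) :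
    (Complex.equivRealProdCLM.symm (r * Real.cos θ, r * Real.sin θ) ^ n)⁻¹
      = ((Real.cos (n * θ) / r ^ n : ℝ) : ℂ) + ((-(Real.sin (n * θ) / r ^ n) : ℝ) : ℂ) *
        Complex.I := by
  have h : Complex.equivRealProdCLM.symm (r * Real.cos θ, r * Real.sin θ)
      = r * Complex.exp (θ * Complex.I) := by
    rw [Complex.exp_mul_I, Complex.equivRealProdCLM_symm_apply]
    push_cast
    ring
  rw [h, mul_pow, mul_inv, ← Complex.exp_nat_mul, ← Complex.exp_neg,
    show -((n : ℂ) * (θ * Complex.I)) = ((-(n * θ) : ℝ) : ℂ) * Complex.I by push_cast; ring,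
    Complex.exp_mul_I, ← Complex.ofReal_cos, ← Complex.ofReal_sin, Real.cos_neg, Real.sin_neg]
  push_cast
  ring

theorem invPowRe_polar (n : ℕ) (r θ : ℝ) :
    invPowRe n (r * Real.cos θ, r * Real.sin θ) = Real.cos (n * θ) / r ^ n := by
  rw [invPowRe, inv_pow_polar]
  simp only [Complex.add_re, Complex.re_ofReal_mul, Complex.ofReal_re, Complex.I_re, mul_zero,
    add_zero]

theorem invPowIm_polar (n : ℕ) (r θ : ℝ) :
    invPowIm n (r * Real.cos θ, r * Real.sin θ) = -(Real.sin (n * θ) / r ^ n) := by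
  rw [invPowIm, inv_pow_polar]
  simp only [Complex.add_im, Complex.im_ofReal_mul, Complex.ofReal_im, Complex.I_im, mul_one,
    zero_add]

theorem exists_polar {p : ℝ × ℝ} (hp : p ≠ 0) :
    ∃ r θ : ℝ, 0 < r ∧ p = (r * Real.cos θ, r * Real.sin θ) := by
  have hz : Complex.equivRealProdCLM.symm p ≠ 0 := by simpa using hp
  refine ⟨‖Complex.equivRealProdCLM.symm p‖, Complex.arg (Complex.equivRealProdCLM.symm p),
    norm_pos_iff.mpr hz, ?_⟩
  rw [Complex.norm_mul_cos_arg, Complex.norm_mul_sin_arg]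
  rfl

/-- First component of the plane field `C (z⁻ᵏ + c z z̄⁻ᵏ⁻¹ - d z̄⁻ᵏ⁻²)`. -/
def waveFst (C c d : ℝ) (k : ℕ) (p : ℝ × ℝ) : ℝ :=
  C * (invPowRe k p + c * (p.1 * invPowRe (k + 1) p + p.2 * invPowIm (k + 1) p)
    - d * invPowRe (k + 2) p)

/-- Second component of the plane field `C (z⁻ᵏ + c z z̄⁻ᵏ⁻¹ - d z̄⁻ᵏ⁻²)`. -/
def waveSnd (C c d : ℝ) (k : ℕ) (p : ℝ × ℝ) : ℝ :=
  C * (invPowIm k p + c * (p.2 * invPowRe (k + 1) p - p.1 * invPowIm (k + 1) p)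
    + d * invPowIm (k + 2) p)

theorem hasPartials_waveFst (C c d : ℝ) (k : ℕ) {p : ℝ × ℝ} (hp : p ≠ 0) :
    HasPartials (waveFst C c d k)
      (C * ((c - k) * invPowRe (k + 1) p
        - c * (k + 1) * (p.1 * invPowRe (k + 2) p + p.2 * invPowIm (k + 2) p)
        + d * (k + 2) * invPowRe (k + 3) p))
      (C * ((c + k) * invPowIm (k + 1) p
        + c * (k + 1) * (p.1 * invPowIm (k + 2) p - p.2 * invPowRe (k + 2) p)
        - d * (k + 2) * invPowIm (k + 3) p)) p := by
  have h := ((((hasPartials_invPowRe k hp).add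
    ((((HasPartials.fst p).mul (hasPartials_invPowRe (k + 1) hp)).add
      ((HasPartials.snd p).mul (hasPartials_invPowIm (k + 1) hp))).const_mul c)).sub
    ((hasPartials_invPowRe (k + 2) hp).const_mul d)).const_mul C)
  unfold HasPartials at h ⊢
  refine h.congr_fderiv ?_
  simp only [add_assoc, Nat.reduceAdd]
  push_cast
  congr 2 <;> ring

theorem hasPartials_waveSnd (C c d : ℝ) (k : ℕ) {p : ℝ × ℝ} (hp : p ≠ 0) :
    HasPartials (waveSnd C c d k)
      (C * (-(c + k) * invPowIm (k + 1) p
        + c * (k + 1) * (p.1 * invPowIm (k + 2) p - p.2 * invPowRe (k + 2) p)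
        - d * (k + 2) * invPowIm (k + 3) p))
      (C * ((c - k) * invPowRe (k + 1) p
        + c * (k + 1) * (p.1 * invPowRe (k + 2) p + p.2 * invPowIm (k + 2) p)
        - d * (k + 2) * invPowRe (k + 3) p)) p := by
  have h := ((((hasPartials_invPowIm k hp).add
    ((((HasPartials.snd p).mul (hasPartials_invPowRe (k + 1) hp)).sub
      ((HasPartials.fst p).mul (hasPartials_invPowIm (k + 1) hp))).const_mul c)).add
    ((hasPartials_invPowIm (k + 2) hp).const_mul d)).const_mul C)
  unfold HasPartials at h ⊢
  refine h.congr_fderiv ?_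
  simp only [add_assoc, Nat.reduceAdd]
  push_cast
  congr 2 <;> ring

theorem lap2_waveFst (C c d : ℝ) (k : ℕ) {p : ℝ × ℝ} (hp : p ≠ 0) :
    lap2 (waveFst C c d k) p = -4 * C * c * (k + 1) * invPowRe (k + 2) p := by
  have hA := hasPartials_invPowRe (k + 1) hp
  have hB := hasPartials_invPowIm (k + 1) hp
  have hA' := hasPartials_invPowRe (k + 2) hp
  have hB' := hasPartials_invPowIm (k + 2) hp
  have hx := ((((hA.const_mul (c - k)).sub
    ((((HasPartials.fst p).mul hA').add ((HasPartials.snd p).mul hB')).const_mul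
      (c * (k + 1)))).add
    ((hasPartials_invPowRe (k + 3) hp).const_mul (d * (k + 2)))).const_mul C).pdx_eq
  have hy := ((((hB.const_mul (c + k)).add
    ((((HasPartials.fst p).mul hB').sub ((HasPartials.snd p).mul hA')).const_mul
      (c * (k + 1)))).sub
    ((hasPartials_invPowIm (k + 3) hp).const_mul (d * (k + 2)))).const_mul C).pdy_eq
  rw [lap2, pdx_congr_of_ne_zero (fun q hq => (hasPartials_waveFst C c d k hq).pdx_eq) hp,
    pdy_congr_of_ne_zero (fun q hq => (hasPartials_waveFst C c d k hq).pdy_eq) hp, hx, hy]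
  simp only [add_assoc, Nat.reduceAdd]
  push_cast
  ring

theorem lap2_waveSnd (C c d : ℝ) (k : ℕ) {p : ℝ × ℝ} (hp : p ≠ 0) :
    lap2 (waveSnd C c d k) p = 4 * C * c * (k + 1) * invPowIm (k + 2) p := by
  have hA := hasPartials_invPowRe (k + 1) hp
  have hB := hasPartials_invPowIm (k + 1) hp
  have hA' := hasPartials_invPowRe (k + 2) hp
  have hB' := hasPartials_invPowIm (k + 2) hp
  have hx := ((((hB.const_mul (-(c + k))).add
    ((((HasPartials.fst p).mul hB').sub ((HasPartials.snd p).mul hA')).const_mul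
      (c * (k + 1)))).sub
    ((hasPartials_invPowIm (k + 3) hp).const_mul (d * (k + 2)))).const_mul C).pdx_eq
  have hy := ((((hA.const_mul (c - k)).add
    ((((HasPartials.fst p).mul hA').add ((HasPartials.snd p).mul hB')).const_mul
      (c * (k + 1)))).sub
    ((hasPartials_invPowRe (k + 3) hp).const_mul (d * (k + 2)))).const_mul C).pdy_eq
  rw [lap2, pdx_congr_of_ne_zero (fun q hq => (hasPartials_waveSnd C c d k hq).pdx_eq) hp,
    pdy_congr_of_ne_zero (fun q hq => (hasPartials_waveSnd C c d k hq).pdy_eq) hp, hx, hy]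
  simp only [add_assoc, Nat.reduceAdd]
  push_cast
  ring

theorem lap2_congr_of_ne_zero {f g : ℝ × ℝ → ℝ} (h : ∀ p, p ≠ 0 → f p = g p)
    {p : ℝ × ℝ} (hp : p ≠ 0) : lap2 f p = lap2 g p := by
  rw [lap2, lap2, pdx_congr_of_ne_zero (fun q hq => pdx_congr_of_ne_zero h hq) hp,
    pdy_congr_of_ne_zero (fun q hq => pdy_congr_of_ne_zero h hq) hp]

theorem polar_wave_eq (C α R : ℝ) (k : ℕ) {r : ℝ} (hr : 0 < r) (θ : ℝ) :
    C * (Real.cos (k * θ) / r ^ k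
        + k * α * (r ^ 2 - R ^ 2) * Real.cos ((k + 2) * θ) / r ^ (k + 2))
      = waveFst C (k * α) (k * α * R ^ 2) k (r * Real.cos θ, r * Real.sin θ) ∧
    C * (-(Real.sin (k * θ) / r ^ k)
        + k * α * (r ^ 2 - R ^ 2) * Real.sin ((k + 2) * θ) / r ^ (k + 2))
      = waveSnd C (k * α) (k * α * R ^ 2) k (r * Real.cos θ, r * Real.sin θ) := by
  have hc : Real.cos ((k + 2) * θ)
      = Real.cos θ * Real.cos ((k + 1) * θ) - Real.sin θ * Real.sin ((k + 1) * θ) := by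
    rw [← Real.cos_add]
    ring_nf
  have hs : Real.sin ((k + 2) * θ)
      = Real.sin θ * Real.cos ((k + 1) * θ) + Real.cos θ * Real.sin ((k + 1) * θ) := by
    rw [← Real.sin_add]
    ring_nf
  simp only [waveFst, waveSnd, invPowRe_polar, invPowIm_polar]
  push_cast
  rw [hc, hs]
  constructor <;> field_simp <;> ring

/-- the exterior part w_k of the perfect plasmon elastic wave satisfies the
Lamé equation μΔw_k + (λ+μ)∇(∇·w_k) = 0 on ℝ² \ {0}. -/
theorem exterior_plasmon_wave_satisfies_lame (lam mu : ℝ) (hmu : 0 < mu)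
    (hlm : 0 < lam + mu) (α : ℝ) (hα : α = (lam + mu) / (lam + 3 * mu))
    (R : ℝ) (hR : 0 < R) (k : ℕ) (hk : 1 ≤ k) (w : ℝ × ℝ → ℝ × ℝ)
    (hw : ∀ r θ : ℝ, 0 < r →
      w (r * Real.cos θ, r * Real.sin θ)
        = (R ^ (2 * k) * (Real.cos ((k : ℝ) * θ) / r ^ k
              + (k : ℝ) * α * (r ^ 2 - R ^ 2) * Real.cos (((k : ℝ) + 2) * θ) / r ^ (k + 2)),
           R ^ (2 * k) * (-(Real.sin ((k : ℝ) * θ) / r ^ k)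
              + (k : ℝ) * α * (r ^ 2 - R ^ 2) * Real.sin (((k : ℝ) + 2) * θ) / r ^ (k + 2)))) :
    ∀ x : ℝ × ℝ, x ≠ 0 → lame2 lam mu w x = (0, 0) := by
  have hne : lam + 3 * mu ≠ 0 := by linarith
  set C := R ^ (2 * k)
  set d := k * α * R ^ 2
  have hfst : ∀ p, p ≠ 0 → (w p).1 = waveFst C (k * α) d k p := by
    intro p hp
    obtain ⟨r, θ, hr, rfl⟩ := exists_polar hp
    rw [hw r θ hr]
    exact (polar_wave_eq C α R k hr θ).1
  have hsnd : ∀ p, p ≠ 0 → (w p).2 = waveSnd C (k * α) d k p := by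
    intro p hp
    obtain ⟨r, θ, hr, rfl⟩ := exists_polar hp
    rw [hw r θ hr]
    exact (polar_wave_eq C α R k hr θ).2
  have hdiv : ∀ p, p ≠ 0 → div2 w p = 2 * C * k * (α - 1) * invPowRe (k + 1) p := by
    intro p hp
    rw [div2, pdx_congr_of_ne_zero hfst hp, pdy_congr_of_ne_zero hsnd hp,
      (hasPartials_waveFst C _ d k hp).pdx_eq, (hasPartials_waveSnd C _ d k hp).pdy_eq]
    ring
  intro x hx
  have hgrad := (hasPartials_invPowRe (k + 1) hx).const_mul (2 * C * k * (α - 1))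
  have hα' : (lam + mu) * (1 - α) = 2 * mu * α := by
    have h : α * (lam + 3 * mu) = lam + mu := by rw [hα, div_mul_cancel₀ _ hne]
    linear_combination -h
  rw [lame2, lap2_congr_of_ne_zero hfst hx, lap2_congr_of_ne_zero hsnd hx,
    pdx_congr_of_ne_zero hdiv hx, pdy_congr_of_ne_zero hdiv hx, hgrad.pdx_eq, hgrad.pdy_eq,
    lap2_waveFst C _ d k hx, lap2_waveSnd C _ d k hx]
  simp only [add_assoc, Nat.reduceAdd, Prod.mk.injEq]
  push_cast
  constructor
  · linear_combination 2 * C * k * (k + 1) * invPowRe (k + 2) x * hα'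
  · linear_combination -2 * C * k * (k + 1) * invPowIm (k + 2) x * hα'
end
end

section
/- Let λ, μ ∈ ℝ with μ > 0 and λ + μ > 0, set α := (λ+μ)/(λ+3μ) and c := −(λ+μ)/(λ+3μ), let R > 0 and let k ≥ 2 be an integer. Define ψ : ℝ² → ℝ² by ψ(x) = ( r^k cos(kθ) − kα(r²−R²) r^{k−2} cos((k−2)θ), r^k sin(kθ) + kα(r²−R²) r^{k−2} sin((k−2)θ) ) for r ≤ R and ψ(x) = R^{2k} (r^{−k} cos(kθ), r^{−k} sin(kθ)) for r > R, and define A : ℝ² → ℝ by A(x) = 1 for ‖x‖ ≤ R and A(x) = c for ‖x‖ > R. Then for every continuously differentiable, compactly supported φ : ℝ² → ℝ², one has ∫_{ℝ²} A(x) [ λ (∇·ψ)(∇·φ) + 2μ ∇^s ψ : ∇^s φ ] dx = 0, where ∇^s u = (∇u + (∇u)ᵀ)/2 and ':' is the Frobenius inner product. -/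
open Real MeasureTheory

noncomputable section

open Set

/-- The derivative of `f` in the radial direction, at polar coordinates `p`. -/
def radialDeriv (f : ℝ × ℝ → ℝ) (p : ℝ × ℝ) : ℝ :=
  cos p.2 * pdx f (polarCoord.symm p) + sin p.2 * pdy f (polarCoord.symm p)

/-- The derivative of `f` in the direction orthogonal to the radius, at polar coordinates `p`. -/
def angularDeriv (f : ℝ × ℝ → ℝ) (p : ℝ × ℝ) : ℝ :=
  cos p.2 * pdy f (polarCoord.symm p) - sin p.2 * pdx f (polarCoord.symm p)

/-- In polar coordinates, the pairing of the field `(f, g)` with the rotated gradients of the two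
components of the Fourier mode `r e^{iθ} ↦ a r * e^{imθ}`, where `a'` is the derivative of `a`. -/
def modePairing (m : ℝ) (a a' : ℝ → ℝ) (f g : ℝ × ℝ → ℝ) (p : ℝ × ℝ) : ℝ :=
  a p.1 * m * (cos (m * p.2) * radialDeriv f p + sin (m * p.2) * radialDeriv g p)
    - a' p.1 * p.1 * (sin (m * p.2) * angularDeriv f p - cos (m * p.2) * angularDeriv g p)

/-- The integral over the circle of radius `r` of the field `(f, g)` against the mode `e^{imθ}`. -/
def circlePairing (m : ℝ) (f g : ℝ × ℝ → ℝ) (r : ℝ) : ℝ :=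
  ∫ θ in (-π)..π, m * (cos (m * θ) * f (polarCoord.symm (r, θ))
    + sin (m * θ) * g (polarCoord.symm (r, θ)))

lemma fderiv_apply_eq_pdx_pdy (f : ℝ × ℝ → ℝ) (x : ℝ × ℝ) (a b : ℝ) :
    fderiv ℝ f x (a, b) = a * pdx f x + b * pdy f x := by
  have : ((a, b) : ℝ × ℝ) = a • ((1 : ℝ), (0 : ℝ)) + b • ((0 : ℝ), (1 : ℝ)) := by simp
  rw [this, map_add, map_smul, map_smul]
  rfl

lemma hasDerivAt_comp_polarCoord_symm_fst {f : ℝ × ℝ → ℝ} {p : ℝ × ℝ}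
    (hf : DifferentiableAt ℝ f (polarCoord.symm p)) :
    HasDerivAt (fun r => f (polarCoord.symm (r, p.2))) (radialDeriv f p) p.1 := by
  have h : HasDerivAt (fun r : ℝ => polarCoord.symm (r, p.2)) (cos p.2, sin p.2) p.1 := by
    simpa [polarCoord_symm_apply] using
      ((hasDerivAt_id p.1).mul_const (cos p.2)).prodMk ((hasDerivAt_id p.1).mul_const (sin p.2))
  have := HasFDerivAt.comp_hasDerivAt p.1 hf.hasFDerivAt h
  rwa [fderiv_apply_eq_pdx_pdy] at this

lemma hasDerivAt_comp_polarCoord_symm_snd {f : ℝ × ℝ → ℝ} {p : ℝ × ℝ}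
    (hf : DifferentiableAt ℝ f (polarCoord.symm p)) :
    HasDerivAt (fun θ => f (polarCoord.symm (p.1, θ))) (p.1 * angularDeriv f p) p.2 := by
  have h : HasDerivAt (fun θ : ℝ => polarCoord.symm (p.1, θ))
      (p.1 * -sin p.2, p.1 * cos p.2) p.2 := by
    simpa [polarCoord_symm_apply] using
      ((hasDerivAt_cos p.2).const_mul p.1).prodMk ((hasDerivAt_sin p.2).const_mul p.1)
  have := HasFDerivAt.comp_hasDerivAt p.2 hf.hasFDerivAt h
  rw [fderiv_apply_eq_pdx_pdy] at this
  have e : p.1 * angularDeriv f p = p.1 * -sin p.2 * pdx f (polarCoord.symm p)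
      + p.1 * cos p.2 * pdy f (polarCoord.symm p) := by
    unfold angularDeriv; ring
  rwa [e]

lemma fderiv_apply_fst {F : ℝ × ℝ → ℝ} {p : ℝ × ℝ} {d : ℝ} (hF : DifferentiableAt ℝ F p)
    (h : HasDerivAt (fun t => F (t, p.2)) d p.1) : fderiv ℝ F p (1, 0) = d := by
  have h1 : HasDerivAt (fun t : ℝ => (t, p.2)) ((1 : ℝ), (0 : ℝ)) p.1 :=
    (hasDerivAt_id p.1).prodMk (hasDerivAt_const p.1 p.2)
  exact (HasFDerivAt.comp_hasDerivAt p.1 hF.hasFDerivAt h1).unique h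

lemma fderiv_apply_snd {F : ℝ × ℝ → ℝ} {p : ℝ × ℝ} {d : ℝ} (hF : DifferentiableAt ℝ F p)
    (h : HasDerivAt (fun t => F (p.1, t)) d p.2) : fderiv ℝ F p (0, 1) = d := by
  have h1 : HasDerivAt (fun t : ℝ => (p.1, t)) ((0 : ℝ), (1 : ℝ)) p.2 :=
    (hasDerivAt_const p.2 p.1).prodMk (hasDerivAt_id p.2)
  exact (HasFDerivAt.comp_hasDerivAt p.2 hF.hasFDerivAt h1).unique h

lemma continuous_modePairing_factors {f : ℝ × ℝ → ℝ} (hf : ContDiff ℝ 1 f) :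
    Continuous (radialDeriv f) ∧ Continuous (angularDeriv f) := by
  have h : Continuous (fderiv ℝ f) := hf.continuous_fderiv one_ne_zero
  have hs := continuous_polarCoord_symm
  have hx : Continuous fun p => pdx f (polarCoord.symm p) := by
    unfold pdx; fun_prop
  have hy : Continuous fun p => pdy f (polarCoord.symm p) := by
    unfold pdy; fun_prop
  unfold radialDeriv angularDeriv
  constructor <;> fun_prop

lemma continuousOn_modePairing {m r₀ r₁ : ℝ} {a a' : ℝ → ℝ} {f g : ℝ × ℝ → ℝ}
    (ha : ContinuousOn a (Icc r₀ r₁)) (ha' : ContinuousOn a' (Icc r₀ r₁))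
    (hf : ContDiff ℝ 1 f) (hg : ContDiff ℝ 1 g) :
    ContinuousOn (modePairing m a a' f g) (Icc (r₀, -π) (r₁, π)) := by
  obtain ⟨hf1, hf2⟩ := continuous_modePairing_factors hf
  obtain ⟨hg1, hg2⟩ := continuous_modePairing_factors hg
  have hmaps : MapsTo Prod.fst (Icc ((r₀, -π) : ℝ × ℝ) (r₁, π)) (Icc r₀ r₁) :=
    fun p hp => ⟨hp.1.1, hp.2.1⟩
  have h1 : ContinuousOn (fun p : ℝ × ℝ => a p.1) (Icc (r₀, -π) (r₁, π)) :=
    ha.comp continuousOn_fst hmaps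
  have h2 : ContinuousOn (fun p : ℝ × ℝ => a' p.1) (Icc (r₀, -π) (r₁, π)) :=
    ha'.comp continuousOn_fst hmaps
  unfold modePairing
  fun_prop

/-- The divergence theorem for a Fourier mode on an annulus, in polar coordinates. -/
lemma setIntegral_modePairing {m r₀ r₁ : ℝ} (hr : r₀ ≤ r₁) (hm : sin (m * π) = 0)
    {a a' : ℝ → ℝ} (ha : ∀ r ∈ Icc r₀ r₁, HasDerivAt a (a' r) r)
    (ha' : ∀ r ∈ Icc r₀ r₁, DifferentiableAt ℝ a' r) {f g : ℝ × ℝ → ℝ}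
    (hf : ContDiff ℝ 1 f) (hg : ContDiff ℝ 1 g) :
    ∫ p in Icc (r₀, -π) (r₁, π), modePairing m a a' f g p
      = a r₁ * circlePairing m f g r₁ - a r₀ * circlePairing m f g r₀ := by
  set F : ℝ × ℝ → ℝ := fun p => a p.1 * (m * (cos (m * p.2) * f (polarCoord.symm p)
    + sin (m * p.2) * g (polarCoord.symm p))) with hF
  set G : ℝ × ℝ → ℝ := fun p => -a' p.1 * (sin (m * p.2) * f (polarCoord.symm p)
    - cos (m * p.2) * g (polarCoord.symm p)) with hG
  have hfd := hf.differentiable one_ne_zero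
  have hgd := hg.differentiable one_ne_zero
  have hmem : ∀ p ∈ Icc ((r₀, -π) : ℝ × ℝ) (r₁, π), p.1 ∈ Icc r₀ r₁ :=
    fun p hp => ⟨hp.1.1, hp.2.1⟩
  have hsymm : Differentiable ℝ polarCoord.symm :=
    fun p => (hasFDerivAt_polarCoord_symm p).differentiableAt
  have hfs : Differentiable ℝ fun p => f (polarCoord.symm p) := hfd.comp hsymm
  have hgs : Differentiable ℝ fun p => g (polarCoord.symm p) := hgd.comp hsymm
  have hFd : ∀ p ∈ Icc ((r₀, -π) : ℝ × ℝ) (r₁, π), DifferentiableAt ℝ F p := by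
    intro p hp
    have h1 : DifferentiableAt ℝ (fun p : ℝ × ℝ => a p.1) p :=
      (ha p.1 (hmem p hp)).differentiableAt.comp p differentiableAt_fst
    have h2 : DifferentiableAt ℝ (fun p : ℝ × ℝ => m * (cos (m * p.2) * f (polarCoord.symm p)
        + sin (m * p.2) * g (polarCoord.symm p))) p := by
      clear ha ha'
      fun_prop
    exact h1.mul h2
  have hGd : ∀ p ∈ Icc ((r₀, -π) : ℝ × ℝ) (r₁, π), DifferentiableAt ℝ G p := by
    intro p hp
    have h1 : DifferentiableAt ℝ (fun p : ℝ × ℝ => a' p.1) p :=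
      (ha' p.1 (hmem p hp)).comp p differentiableAt_fst
    have h2 : DifferentiableAt ℝ (fun p : ℝ × ℝ => sin (m * p.2) * f (polarCoord.symm p)
        - cos (m * p.2) * g (polarCoord.symm p)) p := by
      clear ha ha'
      fun_prop
    exact h1.neg.mul h2
  have hdiv : EqOn (modePairing m a a' f g)
      (fun p => fderiv ℝ F p (1, 0) + fderiv ℝ G p (0, 1)) (Icc (r₀, -π) (r₁, π)) := by
    intro p hp
    have hmθ : HasDerivAt (fun θ => m * θ) m p.2 := by
      simpa using (hasDerivAt_id p.2).const_mul m
    have e1 := fderiv_apply_fst (hFd p hp) ((ha p.1 (hmem p hp)).mul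
      ((((hasDerivAt_comp_polarCoord_symm_fst (hfd (polarCoord.symm p))).const_mul
        (cos (m * p.2))).add ((hasDerivAt_comp_polarCoord_symm_fst
          (hgd (polarCoord.symm p))).const_mul (sin (m * p.2)))).const_mul m))
    have e2 := fderiv_apply_snd (hGd p hp) (((hmθ.sin.mul (hasDerivAt_comp_polarCoord_symm_snd
      (hfd (polarCoord.symm p)))).sub (hmθ.cos.mul (hasDerivAt_comp_polarCoord_symm_snd
        (hgd (polarCoord.symm p))))).const_mul (-a' p.1))
    simp only [e1, e2, modePairing, Prod.mk.eta]
    ring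
  have hcont : ContinuousOn (modePairing m a a' f g) (Icc (r₀, -π) (r₁, π)) :=
    continuousOn_modePairing (fun r hr => (ha r hr).continuousAt.continuousWithinAt)
      (fun r hr => (ha' r hr).continuousAt.continuousWithinAt) hf hg
  have hsub : Ioo r₀ r₁ ×ˢ Ioo (-π) π ⊆ Icc ((r₀, -π) : ℝ × ℝ) (r₁, π) := by
    rintro ⟨r, θ⟩ ⟨⟨h1, h2⟩, h3, h4⟩
    exact ⟨⟨h1.le, h3.le⟩, ⟨h2.le, h4.le⟩⟩
  have key := integral_divergence_prod_Icc_of_hasFDerivAt_of_le F G (fderiv ℝ F) (fderiv ℝ G)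
    (r₀, -π) (r₁, π) ⟨hr, by linarith [pi_pos]⟩
    (fun p hp => (hFd p hp).continuousAt.continuousWithinAt)
    (fun p hp => (hGd p hp).continuousAt.continuousWithinAt)
    (fun p hp => (hFd p (hsub hp)).hasFDerivAt) (fun p hp => (hGd p (hsub hp)).hasFDerivAt)
    ((hcont.congr hdiv.symm).integrableOn_compact isCompact_Icc)
  rw [setIntegral_congr_fun measurableSet_Icc hdiv, key]
  have hper : ∀ r, G (r, π) = G (r, -π) := by
    intro r
    simp [hG, polarCoord_symm_apply, hm]
  simp only [hper, sub_self, zero_add, hF, circlePairing, intervalIntegral.integral_const_mul]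

/-- The Cartesian derivatives of a function given in polar coordinates. -/
lemma pdx_pdy_of_polar {f P : ℝ × ℝ → ℝ} {p : ℝ × ℝ} {X Y : ℝ} (hp : p ∈ polarCoord.target)
    (hfP : ∀ᶠ q in nhds p, f (polarCoord.symm q) = P q) (hP : DifferentiableAt ℝ P p)
    (hX : HasDerivAt (fun r => P (r, p.2)) X p.1)
    (hY : HasDerivAt (fun θ => P (p.1, θ)) (p.1 * Y) p.2) :
    pdx f (polarCoord.symm p) = cos p.2 * X - sin p.2 * Y ∧
      pdy f (polarCoord.symm p) = sin p.2 * X + cos p.2 * Y := by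
  have hp1 : 0 < p.1 := hp.1
  have hsrc : polarCoord.symm p ∈ polarCoord.source := polarCoord.map_target hp
  have hinv : polarCoord (polarCoord.symm p) = p := polarCoord.right_inv hp
  have hdet : (fderivPolarCoordSymm p).det ≠ 0 := by
    rw [det_fderivPolarCoordSymm]; exact hp1.ne'
  have hpol : DifferentiableAt ℝ polarCoord (polarCoord.symm p) := by
    have h := hasFDerivAt_polarCoord_symm p
    rw [← ContinuousLinearMap.coe_toContinuousLinearEquivOfDetNeZero _ hdet] at h
    refine (polarCoord.symm.hasFDerivAt_symm (a := polarCoord.symm p)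
      (f' := (fderivPolarCoordSymm p).toContinuousLinearEquivOfDetNeZero hdet) hsrc
      ?_).differentiableAt
    rw [OpenPartialHomeomorph.symm_symm, hinv]
    exact h
  have hf : DifferentiableAt ℝ f (polarCoord.symm p) := by
    have h1 : DifferentiableAt ℝ (P ∘ polarCoord) (polarCoord.symm p) :=
      DifferentiableAt.comp _ (by rwa [hinv]) hpol
    refine h1.congr_of_eventuallyEq ?_
    have h2 : Filter.Tendsto polarCoord (nhds (polarCoord.symm p)) (nhds p) := by
      have := (polarCoord.continuousAt hsrc).tendsto
      rwa [hinv] at this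
    filter_upwards [h2.eventually hfP, polarCoord.open_source.mem_nhds hsrc] with x hx hxs
    rw [polarCoord.left_inv hxs] at hx
    exact hx
  have e1 : radialDeriv f p = X := by
    refine (hasDerivAt_comp_polarCoord_symm_fst hf).unique (hX.congr_of_eventuallyEq ?_)
    have : ContinuousAt (fun r : ℝ => (r, p.2)) p.1 := by fun_prop
    exact this.tendsto.eventually hfP
  have e2 : p.1 * angularDeriv f p = p.1 * Y := by
    refine (hasDerivAt_comp_polarCoord_symm_snd hf).unique (hY.congr_of_eventuallyEq ?_)
    have : ContinuousAt (fun θ : ℝ => (p.1, θ)) p.2 := by fun_prop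
    exact this.tendsto.eventually hfP
  replace e2 := mul_left_cancel₀ hp1.ne' e2
  unfold radialDeriv at e1
  unfold angularDeriv at e2
  have h := cos_sq_add_sin_sq p.2
  rw [← e1, ← e2]
  constructor
  · linear_combination -pdx f (polarCoord.symm p) * h
  · linear_combination -pdy f (polarCoord.symm p) * h

/-- The stress of the wave inside the disk, paired with the displacement gradient
`!![q1, q2; q3, q4]`, in terms of its polar derivatives. -/
lemma inner_stress_pairing {lam mu α k ρ D K L c s q1 q2 q3 q4 C S C2 S2 X1 X2 Y1 Y2 : ℝ}
    (h : c ^ 2 + s ^ 2 = 1) (hα : α * (lam + 3 * mu) = lam + mu)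
    (hC : C = K * c - L * s) (hS : S = L * c + K * s)
    (hC2 : C2 = K * c + L * s) (hS2 : S2 = L * c - K * s)
    (hX1 : X1 = k * ρ * C - k * α * (2 * ρ + D) * C2) (hY1 : Y1 = -k * ρ * S + k * α * D * S2)
    (hX2 : X2 = k * ρ * S + k * α * (2 * ρ + D) * S2) (hY2 : Y2 = k * ρ * C + k * α * D * C2) :
    lam * ((c * X1 - s * Y1) + (s * X2 + c * Y2)) * (q1 + q4)
        + 2 * mu * ((c * X1 - s * Y1) * q1
          + 2 * (((s * X1 + c * Y1) + (c * X2 - s * Y2)) / 2 * ((q2 + q3) / 2))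
          + (s * X2 + c * Y2) * q4)
      = 2 * mu * α * (k * ρ * (C * (c * q1 + s * q2) + S * (c * q3 + s * q4))
          - k * ρ * (S * (c * q2 - s * q1) - C * (c * q4 - s * q3))
          - k * D * (C2 * (c * q1 + s * q2) - S2 * (c * q3 + s * q4))
          + k * (D + 2 * ρ) * (S2 * (c * q2 - s * q1) + C2 * (c * q4 - s * q3))) := by
  have hK1 : c * C + s * S = K := by rw [hC, hS]; linear_combination K * h
  have hK2 : c * C2 - s * S2 = K := by rw [hC2, hS2]; linear_combination K * h
  have hL : s * C - c * S + s * C2 + c * S2 = 0 := by rw [hC, hS, hC2, hS2]; ring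
  have hd : (c * X1 - s * Y1) + (s * X2 + c * Y2) = 2 * k * ρ * (1 - α) * K := by
    rw [hX1, hX2, hY1, hY2]
    linear_combination 2 * k * ρ * hK1 - 2 * k * α * ρ * hK2
  have hd2 : (c * X1 - s * Y1) - (s * X2 + c * Y2) = -2 * k * α * (ρ + D) * (c * C2 + s * S2) := by
    rw [hX1, hX2, hY1, hY2]; ring
  have hd3 : (s * X1 + c * Y1) + (c * X2 - s * Y2) = 2 * k * α * (ρ + D) * (c * S2 - s * C2) := by
    rw [hX1, hX2, hY1, hY2]; ring
  have hα' : (lam + mu) * (1 - α) = 2 * mu * α := by linear_combination -hα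
  linear_combination (lam + mu) * (q1 + q4) * hd + mu * (q1 - q4) * hd2 + mu * (q2 + q3) * hd3
    + 2 * k * ρ * K * (q1 + q4) * hα' - 2 * mu * α * k * ρ * (q1 + q4) * (hK1 + hK2)
    - 2 * mu * α * k * ρ * (q2 - q3) * hL

/-- The stress of the wave outside the disk, paired with the displacement gradient
`!![q1, q2; q3, q4]`, in terms of its polar derivatives. -/
lemma outer_stress_pairing {lam mu α c s q1 q2 q3 q4 C S X1 X2 Y1 Y2 t : ℝ}
    (hX1 : X1 = -t * C) (hY1 : Y1 = -t * S) (hX2 : X2 = -t * S) (hY2 : Y2 = t * C) :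
    -α * (lam * ((c * X1 - s * Y1) + (s * X2 + c * Y2)) * (q1 + q4)
        + 2 * mu * ((c * X1 - s * Y1) * q1
          + 2 * (((s * X1 + c * Y1) + (c * X2 - s * Y2)) / 2 * ((q2 + q3) / 2))
          + (s * X2 + c * Y2) * q4))
      = 2 * mu * α * (t * (C * (c * q1 + s * q2) + S * (c * q3 + s * q4))
          + t * (S * (c * q2 - s * q1) - C * (c * q4 - s * q3))) := by
  subst hX1 hY1 hX2 hY2
  ring

/-- The amplitude of the anti-holomorphic mode of the stress function inside the disk. -/
def innerAmp (n : ℕ) (R r : ℝ) : ℝ := ((n : ℝ) + 2) * ((r ^ 2 - R ^ 2) * r ^ n)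

/-- The derivative of `innerAmp`. -/
def innerAmp' (n : ℕ) (R r : ℝ) : ℝ :=
  ((n : ℝ) + 2) * (2 * r * r ^ n + (r ^ 2 - R ^ 2) * (n * r ^ (n - 1)))

lemma hasDerivAt_sq_sub_mul_pow (n : ℕ) (R r : ℝ) :
    HasDerivAt (fun r : ℝ => (r ^ 2 - R ^ 2) * r ^ n)
      (2 * r * r ^ n + (r ^ 2 - R ^ 2) * (n * r ^ (n - 1))) r := by
  exact (((hasDerivAt_pow 2 r).sub_const (R ^ 2)).mul (hasDerivAt_pow n r)).congr_deriv
    (by simp)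

lemma hasDerivAt_div_pow (n : ℕ) (B : ℝ) {r : ℝ} (hr : 0 < r) :
    HasDerivAt (fun r : ℝ => B / r ^ n) (-(n * (B / r ^ (n + 1)))) r := by
  have h := ((hasDerivAt_pow n r).inv (pow_ne_zero n hr.ne')).const_mul B
  have e : B * (-(n * r ^ (n - 1)) / (r ^ n) ^ 2) = -(n * (B / r ^ (n + 1))) := by
    rcases n with _ | n
    · simp
    · rw [Nat.add_sub_cancel]
      field_simp
      ring
  rw [← e]
  simpa [div_eq_mul_inv] using h

lemma nr_polarCoord_symm {p : ℝ × ℝ} (hp : 0 < p.1) : nr (polarCoord.symm p) = p.1 := by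
  rw [nr, polarCoord_symm_apply]
  have : (p.1 * cos p.2) ^ 2 + (p.1 * sin p.2) ^ 2 = p.1 ^ 2 := by
    linear_combination p.1 ^ 2 * cos_sq_add_sin_sq p.2
  simp only [this]
  exact sqrt_sq hp.le

/-- The energy density inside the disk, in polar coordinates. -/
lemma inner_energy_density {lam mu α R : ℝ} {n : ℕ} (hα : α * (lam + 3 * mu) = lam + mu)
    {ψ : ℝ × ℝ → ℝ × ℝ}
    (hψ : ∀ r θ : ℝ, 0 ≤ r → r ≤ R →
      ψ (r * cos θ, r * sin θ)
        = (r ^ (n + 2) * cos (((n : ℝ) + 2) * θ)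
              - ((n : ℝ) + 2) * α * (r ^ 2 - R ^ 2) * r ^ n * cos (n * θ),
           r ^ (n + 2) * sin (((n : ℝ) + 2) * θ)
              + ((n : ℝ) + 2) * α * (r ^ 2 - R ^ 2) * r ^ n * sin (n * θ)))
    (φ : ℝ × ℝ → ℝ × ℝ) {p : ℝ × ℝ} (hp : p ∈ polarCoord.target) (hpR : p.1 < R) :
    p.1 * (lam * div2 ψ (polarCoord.symm p) * div2 φ (polarCoord.symm p)
        + 2 * mu * sgFrob ψ φ (polarCoord.symm p))
      = 2 * mu * α * (modePairing ((n : ℝ) + 2) (fun r => r ^ (n + 2))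
          (fun r => ((n : ℝ) + 2) * r ^ (n + 1)) (fun y => (φ y).1) (fun y => (φ y).2) p
        + modePairing (-n) (innerAmp n R) (innerAmp' n R)
          (fun y => (φ y).1) (fun y => (φ y).2) p) := by
  have hp1 : 0 < p.1 := hp.1
  have hev : ∀ᶠ q : ℝ × ℝ in nhds p, 0 ≤ q.1 ∧ q.1 ≤ R := by
    filter_upwards [(continuous_fst.tendsto p).eventually (lt_mem_nhds hp1),
      (continuous_fst.tendsto p).eventually (gt_mem_nhds hpR)] with q h1 h2
    exact ⟨h1.le, h2.le⟩
  have hkθ : HasDerivAt (fun θ : ℝ => ((n : ℝ) + 2) * θ) ((n : ℝ) + 2) p.2 := by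
    simpa using (hasDerivAt_id p.2).const_mul ((n : ℝ) + 2)
  have hnθ : HasDerivAt (fun θ : ℝ => (n : ℝ) * θ) (n : ℝ) p.2 := by
    simpa using (hasDerivAt_id p.2).const_mul (n : ℝ)
  have hpow : HasDerivAt (fun r : ℝ => r ^ (n + 2)) (((n : ℝ) + 2) * p.1 ^ (n + 1)) p.1 := by
    simpa using hasDerivAt_pow (n + 2) p.1
  have hamp := hasDerivAt_sq_sub_mul_pow n R p.1
  set D : ℝ := n * p.1 ^ (n - 1) * (p.1 ^ 2 - R ^ 2) with hD
  have hpD : p.1 * D = n * p.1 ^ n * (p.1 ^ 2 - R ^ 2) := by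
    rcases n with _ | m
    · simp [hD]
    · simp only [hD, Nat.add_sub_cancel]
      ring
  obtain ⟨e1, e2⟩ := pdx_pdy_of_polar (f := fun y => (ψ y).1) (p := p)
    (P := fun q => q.1 ^ (n + 2) * cos (((n : ℝ) + 2) * q.2)
              - ((n : ℝ) + 2) * α * (q.1 ^ 2 - R ^ 2) * q.1 ^ n * cos (n * q.2))
    (X := ((n : ℝ) + 2) * p.1 ^ (n + 1) * cos (((n : ℝ) + 2) * p.2)
      - ((n : ℝ) + 2) * α * (2 * p.1 ^ (n + 1) + D) * cos (n * p.2))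
    (Y := -((n : ℝ) + 2) * p.1 ^ (n + 1) * sin (((n : ℝ) + 2) * p.2)
      + ((n : ℝ) + 2) * α * D * sin (n * p.2)) hp
    (by
      filter_upwards [hev] with q hq
      rw [polarCoord_symm_apply, hψ q.1 q.2 hq.1 hq.2])
    (by fun_prop)
    (((hpow.mul_const (cos (((n : ℝ) + 2) * p.2))).sub
      (hamp.mul_const (((n : ℝ) + 2) * α * cos (n * p.2)))).congr_deriv (by rw [hD]; ring)
      |>.congr_of_eventuallyEq (.of_forall fun r => by simp only [Pi.sub_apply]; ring))
    (((hkθ.cos.const_mul (p.1 ^ (n + 2))).sub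
      (hnθ.cos.const_mul (((n : ℝ) + 2) * α * (p.1 ^ 2 - R ^ 2) * p.1 ^ n))).congr_deriv (by
        linear_combination -(((n : ℝ) + 2) * α * sin (n * p.2)) * hpD))
  obtain ⟨e3, e4⟩ := pdx_pdy_of_polar (f := fun y => (ψ y).2) (p := p)
    (P := fun q => q.1 ^ (n + 2) * sin (((n : ℝ) + 2) * q.2)
              + ((n : ℝ) + 2) * α * (q.1 ^ 2 - R ^ 2) * q.1 ^ n * sin (n * q.2))
    (X := ((n : ℝ) + 2) * p.1 ^ (n + 1) * sin (((n : ℝ) + 2) * p.2)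
      + ((n : ℝ) + 2) * α * (2 * p.1 ^ (n + 1) + D) * sin (n * p.2))
    (Y := ((n : ℝ) + 2) * p.1 ^ (n + 1) * cos (((n : ℝ) + 2) * p.2)
      + ((n : ℝ) + 2) * α * D * cos (n * p.2)) hp
    (by
      filter_upwards [hev] with q hq
      rw [polarCoord_symm_apply, hψ q.1 q.2 hq.1 hq.2])
    (by fun_prop)
    (((hpow.mul_const (sin (((n : ℝ) + 2) * p.2))).add
      (hamp.mul_const (((n : ℝ) + 2) * α * sin (n * p.2)))).congr_deriv (by rw [hD]; ring)
      |>.congr_of_eventuallyEq (.of_forall fun r => by simp only [Pi.add_apply]; ring))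
    (((hkθ.sin.const_mul (p.1 ^ (n + 2))).add
      (hnθ.sin.const_mul (((n : ℝ) + 2) * α * (p.1 ^ 2 - R ^ 2) * p.1 ^ n))).congr_deriv (by
        linear_combination -(((n : ℝ) + 2) * α * cos (n * p.2)) * hpD))
  have hk : ((n : ℝ) + 2) * p.2 = ((n : ℝ) + 1) * p.2 + p.2 := by ring
  have hn : (n : ℝ) * p.2 = ((n : ℝ) + 1) * p.2 - p.2 := by ring
  have alg := inner_stress_pairing (lam := lam) (mu := mu) (D := D) (k := (n : ℝ) + 2)
    (ρ := p.1 ^ (n + 1)) (q1 := pdx (fun y => (φ y).1) (polarCoord.symm p))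
    (q2 := pdy (fun y => (φ y).1) (polarCoord.symm p))
    (q3 := pdx (fun y => (φ y).2) (polarCoord.symm p))
    (q4 := pdy (fun y => (φ y).2) (polarCoord.symm p))
    (K := cos (((n : ℝ) + 1) * p.2)) (L := sin (((n : ℝ) + 1) * p.2))
    (C := cos (((n : ℝ) + 2) * p.2)) (S := sin (((n : ℝ) + 2) * p.2))
    (C2 := cos (n * p.2)) (S2 := sin (n * p.2))
    (cos_sq_add_sin_sq p.2) hα
    (by rw [hk, cos_add]) (by rw [hk, sin_add]) (by rw [hn, cos_sub]) (by rw [hn, sin_sub])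
    rfl rfl rfl rfl
  have hρ : p.1 ^ (n + 1) = p.1 * p.1 ^ n := pow_succ' _ _
  have hD' : (p.1 ^ 2 - R ^ 2) * (n * p.1 ^ (n - 1)) = D := by rw [hD]; ring
  simp only [div2, sgFrob, sg11, sg12, sg22, modePairing, radialDeriv, angularDeriv, innerAmp,
    innerAmp', e1, e2, e3, e4, neg_mul, cos_neg, sin_neg, hD'] at alg ⊢
  clear_value D
  generalize pdx (fun y => (φ y).1) (polarCoord.symm p) = q1 at alg ⊢
  generalize pdy (fun y => (φ y).1) (polarCoord.symm p) = q2 at alg ⊢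
  generalize pdx (fun y => (φ y).2) (polarCoord.symm p) = q3 at alg ⊢
  generalize pdy (fun y => (φ y).2) (polarCoord.symm p) = q4 at alg ⊢
  rw [alg, pow_succ p.1 (n + 1), hρ]
  linear_combination -2 * mu * α * ((n : ℝ) + 2) * (cos (n * p.2) * (cos p.2 * q1 + sin p.2 * q2)
    - sin (n * p.2) * (cos p.2 * q3 + sin p.2 * q4)) * hpD

/-- The energy density outside the disk, in polar coordinates. -/
lemma outer_energy_density (lam mu α : ℝ) {B R : ℝ} {k : ℕ} {ψ : ℝ × ℝ → ℝ × ℝ}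
    (hψ : ∀ r θ : ℝ, R < r →
      ψ (r * cos θ, r * sin θ) = (B * (cos ((k : ℝ) * θ) / r ^ k), B * (sin ((k : ℝ) * θ) / r ^ k)))
    (φ : ℝ × ℝ → ℝ × ℝ) {p : ℝ × ℝ} (hp : p ∈ polarCoord.target) (hpR : R < p.1) :
    p.1 * (-α * (lam * div2 ψ (polarCoord.symm p) * div2 φ (polarCoord.symm p)
        + 2 * mu * sgFrob ψ φ (polarCoord.symm p)))
      = 2 * mu * α * modePairing k (fun r => B / r ^ k) (fun r => -(k * (B / r ^ (k + 1))))
          (fun y => (φ y).1) (fun y => (φ y).2) p := by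
  have hp1 : 0 < p.1 := hp.1
  have hp0 := hp1.ne'
  have hev : ∀ᶠ q : ℝ × ℝ in nhds p, R < q.1 :=
    (continuous_fst.tendsto p).eventually (lt_mem_nhds hpR)
  have hkθ : HasDerivAt (fun θ : ℝ => (k : ℝ) * θ) (k : ℝ) p.2 := by
    simpa using (hasDerivAt_id p.2).const_mul (k : ℝ)
  have hamp := hasDerivAt_div_pow k B hp1
  have hτ : p.1 * (B / p.1 ^ (k + 1)) = B / p.1 ^ k := by
    rw [pow_succ]
    field_simp
  set τ : ℝ := B / p.1 ^ (k + 1) with hτdef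
  have hdiff : DifferentiableAt ℝ (fun q : ℝ × ℝ => q.1 ^ k) p := by fun_prop
  have hpk : p.1 ^ k ≠ 0 := pow_ne_zero k hp0
  obtain ⟨e1, e2⟩ := pdx_pdy_of_polar (f := fun y => (ψ y).1) (p := p)
    (P := fun q => B * (cos ((k : ℝ) * q.2) / q.1 ^ k))
    (X := -(k * τ) * cos (k * p.2)) (Y := -(k * τ) * sin (k * p.2)) hp
    (by
      filter_upwards [hev] with q hq
      rw [polarCoord_symm_apply, hψ q.1 q.2 hq])
    (by fun_prop (disch := assumption))
    ((hamp.mul_const (cos (k * p.2))).congr_of_eventuallyEq (.of_forall fun r => by ring))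
    ((hkθ.cos.const_mul (B / p.1 ^ k)).congr_deriv (by rw [← hτ]; ring)
      |>.congr_of_eventuallyEq (.of_forall fun θ => by ring))
  obtain ⟨e3, e4⟩ := pdx_pdy_of_polar (f := fun y => (ψ y).2) (p := p)
    (P := fun q => B * (sin ((k : ℝ) * q.2) / q.1 ^ k))
    (X := -(k * τ) * sin (k * p.2)) (Y := k * τ * cos (k * p.2)) hp
    (by
      filter_upwards [hev] with q hq
      rw [polarCoord_symm_apply, hψ q.1 q.2 hq])
    (by fun_prop (disch := assumption))
    ((hamp.mul_const (sin (k * p.2))).congr_of_eventuallyEq (.of_forall fun r => by ring))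
    ((hkθ.sin.const_mul (B / p.1 ^ k)).congr_deriv (by rw [← hτ]; ring)
      |>.congr_of_eventuallyEq (.of_forall fun θ => by ring))
  have alg := outer_stress_pairing (lam := lam) (mu := mu) (α := α) (t := k * τ)
    (c := cos p.2) (s := sin p.2) (C := cos (k * p.2)) (S := sin (k * p.2))
    (q1 := pdx (fun y => (φ y).1) (polarCoord.symm p))
    (q2 := pdy (fun y => (φ y).1) (polarCoord.symm p))
    (q3 := pdx (fun y => (φ y).2) (polarCoord.symm p))
    (q4 := pdy (fun y => (φ y).2) (polarCoord.symm p)) rfl rfl rfl rfl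
  simp only [div2, sgFrob, sg11, sg12, sg22, modePairing, radialDeriv, angularDeriv, e1, e2, e3, e4]
    at alg ⊢
  rw [alg, ← hτdef, ← hτ]
  ring

lemma Ioo_prod_Ioo_ae_eq_Icc (r₀ r₁ : ℝ) :
    Ioo r₀ r₁ ×ˢ Ioo (-π) π =ᵐ[volume] Icc ((r₀, -π) : ℝ × ℝ) (r₁, π) := by
  have h : Icc ((r₀, -π) : ℝ × ℝ) (r₁, π) = Icc r₀ r₁ ×ˢ Icc (-π) π := Icc_prod_eq _ _
  rw [h, Measure.volume_eq_prod]
  exact Measure.set_prod_ae_eq Ioo_ae_eq_Icc Ioo_ae_eq_Icc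

/-- Splitting an integral in polar coordinates along a circle, for a function vanishing outside
a disk. -/
lemma setIntegral_polarCoord_target_eq_add {R M : ℝ} (hR : 0 < R) {f g₁ g₂ : ℝ × ℝ → ℝ}
    (h₁ : ∀ p ∈ polarCoord.target, p.1 < R → f p = g₁ p)
    (h₂ : ∀ p ∈ polarCoord.target, R < p.1 → f p = g₂ p)
    (h₀ : ∀ p ∈ polarCoord.target, M ≤ p.1 → f p = 0)
    (hg₁ : ContinuousOn g₁ (Icc (0, -π) (R, π))) (hg₂ : ContinuousOn g₂ (Icc (R, -π) (M, π))) :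
    ∫ p in polarCoord.target, f p
      = (∫ p in Icc (0, -π) (R, π), g₁ p) + ∫ p in Icc (R, -π) (M, π), g₂ p := by
  set S₁ : Set (ℝ × ℝ) := Ioo 0 R ×ˢ Ioo (-π) π with hS₁
  set S₂ : Set (ℝ × ℝ) := Ioo R M ×ˢ Ioo (-π) π with hS₂
  have hm₁ : MeasurableSet S₁ := measurableSet_Ioo.prod measurableSet_Ioo
  have hm₂ : MeasurableSet S₂ := measurableSet_Ioo.prod measurableSet_Ioo
  have hsub₁ : S₁ ⊆ polarCoord.target := fun p hp => ⟨hp.1.1, hp.2⟩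
  have hsub₂ : S₂ ⊆ polarCoord.target := fun p hp => ⟨hR.trans hp.1.1, hp.2⟩
  have hdisj : Disjoint S₁ S₂ :=
    Set.disjoint_left.2 fun p hp hp' => lt_asymm hp.1.2 hp'.1.1
  have hne : ∀ᵐ p : ℝ × ℝ, p.1 ≠ R := by
    rw [Measure.volume_eq_prod]
    exact Measure.quasiMeasurePreserving_fst.ae (Measure.ae_ne volume R)
  have heq₁ : EqOn f g₁ S₁ := fun p hp => h₁ p (hsub₁ hp) hp.1.2
  have heq₂ : EqOn f g₂ S₂ := fun p hp => h₂ p (hsub₂ hp) hp.1.1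
  have hint₁ : IntegrableOn g₁ S₁ :=
    (integrableOn_congr_set_ae (Ioo_prod_Ioo_ae_eq_Icc 0 R)).2
      (hg₁.integrableOn_compact isCompact_Icc)
  have hint₂ : IntegrableOn g₂ S₂ :=
    (integrableOn_congr_set_ae (Ioo_prod_Ioo_ae_eq_Icc R M)).2
      (hg₂.integrableOn_compact isCompact_Icc)
  have hred : ∫ p in polarCoord.target, f p = ∫ p in S₁ ∪ S₂, f p := by
    refine setIntegral_eq_of_subset_of_ae_sdiff_eq_zero
      polarCoord.open_target.measurableSet.nullMeasurableSet (union_subset hsub₁ hsub₂) ?_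
    filter_upwards [hne] with p hpR hp
    refine h₀ p hp.1 (not_lt.1 fun hpM => hp.2 ?_)
    rcases hpR.lt_or_gt with h | h
    · exact Or.inl ⟨⟨hp.1.1, h⟩, hp.1.2⟩
    · exact Or.inr ⟨⟨h, hpM⟩, hp.1.2⟩
  rw [hred, setIntegral_union hdisj hm₂ (hint₁.congr_fun heq₁.symm hm₁)
    (hint₂.congr_fun heq₂.symm hm₂), setIntegral_congr_fun hm₁ heq₁,
    setIntegral_congr_fun hm₂ heq₂, setIntegral_congr_set (Ioo_prod_Ioo_ae_eq_Icc 0 R),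
    setIntegral_congr_set (Ioo_prod_Ioo_ae_eq_Icc R M)]

lemma exists_polarCoord_symm_notMem_tsupport {φ : ℝ × ℝ → ℝ × ℝ} (hφ : HasCompactSupport φ)
    (R : ℝ) : ∃ M, R ≤ M ∧ ∀ p : ℝ × ℝ, M ≤ p.1 → polarCoord.symm p ∉ tsupport φ := by
  obtain ⟨B, hB⟩ := hφ.isBounded.exists_norm_le
  refine ⟨max R (2 * |B| + 1), le_max_left _ _, fun p hp hmem => ?_⟩
  have h := hB _ hmem
  rw [polarCoord_symm_apply] at h
  have h1 := (norm_fst_le _).trans h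
  have h2 := (norm_snd_le _).trans h
  simp only [norm_eq_abs] at h1 h2
  have hp' : 2 * |B| + 1 ≤ p.1 := (le_max_right _ _).trans hp
  have e : p.1 ^ 2 = (p.1 * cos p.2) ^ 2 + (p.1 * sin p.2) ^ 2 := by
    linear_combination -p.1 ^ 2 * cos_sq_add_sin_sq p.2
  have hle := le_abs_self B
  have hB0 := abs_nonneg B
  have s1 := sq_le_sq' (abs_le.1 (h1.trans hle)).1 (abs_le.1 (h1.trans hle)).2
  have s2 := sq_le_sq' (abs_le.1 (h2.trans hle)).1 (abs_le.1 (h2.trans hle)).2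
  nlinarith

lemma div2_sgFrob_eq_zero_of_notMem_tsupport {φ : ℝ × ℝ → ℝ × ℝ} {x : ℝ × ℝ}
    (hx : x ∉ tsupport φ) (ψ : ℝ × ℝ → ℝ × ℝ) : div2 φ x = 0 ∧ sgFrob ψ φ x = 0 := by
  have h := notMem_tsupport_iff_eventuallyEq.1 hx
  have h1 : fderiv ℝ (fun y => (φ y).1) x = 0 := by
    have : (fun y => (φ y).1) =ᶠ[nhds x] fun _ => 0 := h.mono fun y hy => by simp [hy]
    rw [this.fderiv_eq]
    simp
  have h2 : fderiv ℝ (fun y => (φ y).2) x = 0 := by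
    have : (fun y => (φ y).2) =ᶠ[nhds x] fun _ => 0 := h.mono fun y hy => by simp [hy]
    rw [this.fderiv_eq]
    simp
  simp [div2, sgFrob, sg11, sg12, sg22, pdx, pdy, h1, h2]

lemma circlePairing_eq_zero_of_notMem_tsupport {φ : ℝ × ℝ → ℝ × ℝ} {r : ℝ}
    (hr : ∀ θ, polarCoord.symm (r, θ) ∉ tsupport φ) (m : ℝ) :
    circlePairing m (fun y => (φ y).1) (fun y => (φ y).2) r = 0 := by
  have h : ∀ θ, φ (polarCoord.symm (r, θ)) = 0 := fun θ => image_eq_zero_of_notMem_tsupport (hr θ)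
  simp only [circlePairing, h]
  simp

/-- the perfect plasmon elastic wave ψ of the configuration with regular material
in the disk B_R and plasmonic coefficient c outside is a weak solution of
∇·(A C_{λ,μ} ∇ˢψ) = 0 on ℝ². -/
theorem core_plasmon_wave_is_weak_solution (lam mu : ℝ) (hmu : 0 < mu)
    (hlm : 0 < lam + mu) (α c : ℝ) (hα : α = (lam + mu) / (lam + 3 * mu))
    (hc : c = -((lam + mu) / (lam + 3 * mu)))
    (R : ℝ) (hR : 0 < R) (k : ℕ) (hk : 2 ≤ k)
    (ψ : ℝ × ℝ → ℝ × ℝ)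
    (hψin : ∀ r θ : ℝ, 0 ≤ r → r ≤ R →
      ψ (r * Real.cos θ, r * Real.sin θ)
        = (r ^ k * Real.cos ((k : ℝ) * θ)
              - (k : ℝ) * α * (r ^ 2 - R ^ 2) * r ^ (k - 2) * Real.cos (((k : ℝ) - 2) * θ),
           r ^ k * Real.sin ((k : ℝ) * θ)
              + (k : ℝ) * α * (r ^ 2 - R ^ 2) * r ^ (k - 2) * Real.sin (((k : ℝ) - 2) * θ)))
    (hψout : ∀ r θ : ℝ, R < r →
      ψ (r * Real.cos θ, r * Real.sin θ)
        = (R ^ (2 * k) * (Real.cos ((k : ℝ) * θ) / r ^ k),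
           R ^ (2 * k) * (Real.sin ((k : ℝ) * θ) / r ^ k)))
    (A : ℝ × ℝ → ℝ)
    (hA : ∀ x : ℝ × ℝ, (nr x ≤ R → A x = 1) ∧ (R < nr x → A x = c)) :
    ∀ φ : ℝ × ℝ → ℝ × ℝ, ContDiff ℝ 1 φ → HasCompactSupport φ →
      ∫ x : ℝ × ℝ,
        A x * (lam * div2 ψ x * div2 φ x + 2 * mu * sgFrob ψ φ x) = 0 := by
  intro φ hφ hsupp
  have hden : lam + 3 * mu ≠ 0 := by linarith
  have hα' : α * (lam + 3 * mu) = lam + mu := by rw [hα, div_mul_cancel₀ _ hden]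
  have hcα : c = -α := by rw [hc, hα]
  obtain ⟨n, rfl⟩ := Nat.exists_eq_add_of_le' hk
  obtain ⟨M, hRM, hM⟩ := exists_polarCoord_symm_notMem_tsupport hsupp R
  have hf : ContDiff ℝ 1 fun y => (φ y).1 := contDiff_fst.comp hφ
  have hg : ContDiff ℝ 1 fun y => (φ y).2 := contDiff_snd.comp hφ
  simp only [Nat.add_sub_cancel, Nat.cast_add, Nat.cast_ofNat, add_sub_cancel_right] at hψin
  have hsin : ∀ j : ℕ, sin ((j : ℝ) * π) = 0 := sin_nat_mul_pi
  have hk' : sin (((n : ℝ) + 2) * π) = 0 := by exact_mod_cast hsin (n + 2)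
  have hn' : sin (-(n : ℝ) * π) = 0 := by rw [neg_mul, sin_neg, hsin, neg_zero]
  have ha : ∀ r ∈ Icc 0 R, HasDerivAt (fun r : ℝ => r ^ (n + 2)) (((n : ℝ) + 2) * r ^ (n + 1)) r :=
    fun r _ => by simpa using hasDerivAt_pow (n + 2) r
  have ha' : Differentiable ℝ fun r : ℝ => ((n : ℝ) + 2) * r ^ (n + 1) := by fun_prop
  have hb : ∀ r ∈ Icc 0 R, HasDerivAt (innerAmp n R) (innerAmp' n R r) r :=
    fun r _ => (hasDerivAt_sq_sub_mul_pow n R r).const_mul _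
  have hb' : Differentiable ℝ (innerAmp' n R) := by unfold innerAmp'; fun_prop
  have ho : ∀ r ∈ Icc R M, HasDerivAt (fun r : ℝ => R ^ (2 * (n + 2)) / r ^ (n + 2))
      (-(((n + 2 : ℕ) : ℝ) * (R ^ (2 * (n + 2)) / r ^ (n + 2 + 1)))) r :=
    fun r hr => hasDerivAt_div_pow _ _ (hR.trans_le hr.1)
  have ho' : ∀ r ∈ Icc R M, DifferentiableAt ℝ
      (fun r : ℝ => -(((n + 2 : ℕ) : ℝ) * (R ^ (2 * (n + 2)) / r ^ (n + 2 + 1)))) r :=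
    fun r hr => ((hasDerivAt_div_pow _ _
      (hR.trans_le hr.1)).differentiableAt.const_mul _).neg
  have hc₁ := continuousOn_modePairing (m := (n : ℝ) + 2)
    (fun r hr => (ha r hr).continuousAt.continuousWithinAt) ha'.continuous.continuousOn hf hg
  have hc₂ := continuousOn_modePairing (m := -(n : ℝ))
    (fun r hr => (hb r hr).continuousAt.continuousWithinAt) hb'.continuous.continuousOn hf hg
  have hc₃ := continuousOn_modePairing (m := ((n + 2 : ℕ) : ℝ))
    (fun r hr => (ho r hr).continuousAt.continuousWithinAt)
    (fun r hr => (ho' r hr).continuousAt.continuousWithinAt) hf hg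
  have hsplit := setIntegral_polarCoord_target_eq_add hR (M := M)
    (f := fun p => p.1 • (A (polarCoord.symm p) *
      (lam * div2 ψ (polarCoord.symm p) * div2 φ (polarCoord.symm p)
        + 2 * mu * sgFrob ψ φ (polarCoord.symm p))))
    (fun p hp hpR => by
      rw [(hA _).1 ((nr_polarCoord_symm hp.1).trans_le hpR.le), one_mul, smul_eq_mul]
      exact inner_energy_density hα' hψin φ hp hpR)
    (fun p hp hpR => by
      rw [(hA _).2 (hpR.trans_eq (nr_polarCoord_symm hp.1).symm), hcα, smul_eq_mul]
      exact outer_energy_density lam mu α hψout φ hp hpR)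
    (fun p _ hpM => by
      obtain ⟨h1, h2⟩ := div2_sgFrob_eq_zero_of_notMem_tsupport (hM p hpM) ψ
      simp only [h1, h2, mul_zero, add_zero, smul_zero])
    ((hc₁.add hc₂).const_mul _) (hc₃.const_mul _)
  rw [← integral_comp_polarCoord_symm, hsplit, integral_const_mul, integral_const_mul,
    integral_add' (hc₁.integrableOn_compact isCompact_Icc)
      (hc₂.integrableOn_compact isCompact_Icc),
    setIntegral_modePairing hR.le hk' ha (fun r _ => ha' r) hf hg,
    setIntegral_modePairing hR.le hn' hb (fun r _ => hb' r) hf hg,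
    setIntegral_modePairing hRM (hsin (n + 2)) ho ho' hf hg,
    circlePairing_eq_zero_of_notMem_tsupport (fun θ => hM (M, θ) le_rfl)]
  have hb0 : innerAmp n R 0 * circlePairing (-(n : ℝ)) (fun y => (φ y).1) (fun y => (φ y).2) 0
      = 0 := by
    rcases eq_or_ne n 0 with rfl | hn
    · simp [circlePairing]
    · simp [innerAmp, hn]
  have hbR : innerAmp n R R = 0 := by simp [innerAmp]
  have hpow : R ^ (2 * (n + 2)) / R ^ (n + 2) = R ^ (n + 2) := by
    rw [two_mul, pow_add, mul_div_cancel_right₀ _ (pow_ne_zero _ hR.ne')]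
  rw [hb0, hbR, hpow]
  push_cast
  ring
end
end
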